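/- arXiv:0709.4241 — 2 statements merged into one kernel-verified Lean document; each statement's English description precedes it below -/
import Mathlib

section
/- For every integer m ≥ 2 one has, in the complex numbers, Σ_{k=1}^{m−1} e^{−ikπ/m} = i·sin(π/m)/(cos(π/m) − 1), and consequently Σ_{k=0}^{m} e^{ikπ/m} + i·sin(π/m)/(cos(π/m) − 1) = 0. In other words, for the dihedral group G_m of order 2m with Coxeter element c = st, the sum of the points M(w) over the elements w ∈ G_m that are not c-singletons equals the extra vertex P = i·sin(π/m)/(cos(π/m) − 1) of the associahedron, so the vertex barycentre of the associahedron Ass^a_c(G_m) (vertices {e^{ikπ/m} : 0 ≤ k ≤ m} ∪ {P}) equals the vertex barycentre of the permutahedron Perm^a(G_m) (vertices {e^{ikπ/m} : 0 ≤ k ≤ m} ∪ {e^{−ikπ/m} : 1 ≤ k ≤ m−1}), namely the origin. -/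
open Complex

theorem one_add_exp_mul_I_eq (θ : ℝ) (h : Real.cos θ ≠ 1) :
    1 + Complex.exp (θ * I) =
      -(I * (Real.sin θ : ℂ) / ((Real.cos θ : ℂ) - 1)) * (1 - Complex.exp (θ * I)) := by
  have hc : (Real.cos θ : ℂ) - 1 ≠ 0 := sub_ne_zero.mpr (mod_cast h)
  have hsc : (Real.sin θ : ℂ) ^ 2 + (Real.cos θ : ℂ) ^ 2 = 1 :=
    mod_cast Real.sin_sq_add_cos_sq θ
  rw [exp_mul_I, ← ofReal_cos, ← ofReal_sin]
  field_simp
  linear_combination hsc - (Real.sin θ : ℂ) ^ 2 * I_sq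

theorem exp_mul_I_ne_one_of_cos_ne_one {θ : ℝ} (h : Real.cos θ ≠ 1) :
    Complex.exp (θ * I) ≠ 1 := by
  intro h1
  apply h
  simpa [exp_ofReal_mul_I_re] using congrArg Complex.re h1

/-- If `e^{iθ}` is an `m`-th root of `-1`, the powers `e^{ikθ}` with `0 < k < m` sum to
`-i·sin θ/(cos θ - 1)`. -/
theorem sum_Ico_exp_mul_I_pow {m : ℕ} (hm : 1 ≤ m) {θ : ℝ} (h : Real.cos θ ≠ 1)
    (hpow : Complex.exp (θ * I) ^ m = -1) :
    ∑ k ∈ Finset.Ico 1 m, Complex.exp (θ * I) ^ k =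
      -(I * (Real.sin θ : ℂ) / ((Real.cos θ : ℂ) - 1)) := by
  have hz : 1 - Complex.exp (θ * I) ≠ 0 :=
    sub_ne_zero.mpr (exp_mul_I_ne_one_of_cos_ne_one h).symm
  apply mul_right_cancel₀ hz
  rw [← one_add_exp_mul_I_eq θ h]
  have hg := mul_neg_geom_sum (Complex.exp (θ * I)) m
  rw [Finset.range_eq_Ico, Finset.sum_eq_sum_Ico_succ_bot (by omega), hpow] at hg
  linear_combination hg

/-- barycentres for dihedral groups.  For every integer `m ≥ 2` one has
`∑_{k=1}^{m-1} e^{-ikπ/m} = i·sin(π/m)/(cos(π/m) - 1)`, and consequently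
`∑_{k=0}^{m} e^{ikπ/m} + i·sin(π/m)/(cos(π/m) - 1) = 0`.  In other words, for the dihedral
group `G_m` with Coxeter element `c = st`, the sum of the points `M(w)` over the
non-`c`-singletons `w ∈ G_m` equals the extra vertex `P = i·sin(π/m)/(cos(π/m) - 1)` of the
associahedron, so the vertex barycentre of the associahedron `Ass^a_c(G_m)` (vertices
`{e^{ikπ/m} : 0 ≤ k ≤ m} ∪ {P}`) equals the vertex barycentre of the permutahedron
`Perm^a(G_m)` (vertices `{e^{ikπ/m} : 0 ≤ k ≤ m} ∪ {e^{-ikπ/m} : 1 ≤ k ≤ m-1}`),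
namely the origin. -/
theorem statement14 (m : ℕ) (hm : 2 ≤ m) :
    (∑ k ∈ Finset.Icc 1 (m - 1),
        Complex.exp (-(Complex.I * ((k : ℂ) * (Real.pi : ℂ) / (m : ℂ))))
      = Complex.I * (Real.sin (Real.pi / m) : ℂ) / ((Real.cos (Real.pi / m) : ℂ) - 1)) ∧
    (∑ k ∈ Finset.range (m + 1),
        Complex.exp (Complex.I * ((k : ℂ) * (Real.pi : ℂ) / (m : ℂ)))
      + Complex.I * (Real.sin (Real.pi / m) : ℂ) / ((Real.cos (Real.pi / m) : ℂ) - 1)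
      = 0) := by
  have hm0 : (m : ℂ) ≠ 0 := by exact_mod_cast (by omega : m ≠ 0)
  have hmpos : (0 : ℝ) < m := by exact_mod_cast (by omega : 0 < m)
  have hcos : Real.cos (Real.pi / m) ≠ 1 := by
    have h0 : 0 < Real.pi / m := div_pos Real.pi_pos hmpos
    have hle : Real.pi / m ≤ Real.pi := div_le_self Real.pi_pos.le (by exact_mod_cast (by omega))
    have hlt := Real.cos_lt_cos_of_nonneg_of_le_pi le_rfl hle h0
    rw [Real.cos_zero] at hlt
    exact hlt.ne
  have hpow : Complex.exp ((Real.pi / m : ℝ) * I) ^ m = -1 := by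
    rw [← Complex.exp_nat_mul, ← exp_pi_mul_I]
    congr 1
    push_cast
    field_simp
  have hpow_neg : Complex.exp ((-(Real.pi / m) : ℝ) * I) ^ m = -1 := by
    rw [ofReal_neg, neg_mul, Complex.exp_neg, inv_pow, hpow, inv_neg, inv_one]
  constructor
  · have hsum := sum_Ico_exp_mul_I_pow (by omega) (by rwa [Real.cos_neg]) hpow_neg
    rw [Real.cos_neg, Real.sin_neg, ofReal_neg (Real.sin _), mul_neg, neg_div, neg_neg] at hsum
    have hIcc : Finset.Icc 1 (m - 1) = Finset.Ico 1 m := by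
      ext k
      simp only [Finset.mem_Icc, Finset.mem_Ico]
      omega
    rw [hIcc, ← hsum]
    refine Finset.sum_congr rfl fun k _ => ?_
    rw [← Complex.exp_nat_mul]
    congr 1
    push_cast
    ring
  · have hsum := sum_Ico_exp_mul_I_pow (by omega) hcos hpow
    have hterm (k : ℕ) : Complex.exp (I * ((k : ℂ) * (Real.pi : ℂ) / (m : ℂ))) =
        Complex.exp ((Real.pi / m : ℝ) * I) ^ k := by
      rw [← Complex.exp_nat_mul]
      congr 1
      push_cast
      ring
    simp only [hterm]
    rw [Finset.sum_range_succ, Finset.range_eq_Ico,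
      Finset.sum_eq_sum_Ico_succ_bot (by omega), hsum, hpow]
    ring
end

section
/- Let n ≥ 2 and let the symmetric group S_{2n} act on ℝ^{2n} by permuting coordinates. Let a := Σ_{k=1}^{2n} (k − (2n+1)/2)·e_k, let V′ := {x ∈ ℝ^{2n} : x_i + x_{2n+1−i} = 0 for all 1 ≤ i ≤ n}, and let W_n ≤ S_{2n} be the subgroup (a Coxeter group of type B_n) generated by the transposition s₀ = (n, n+1) and the products s_{n−i} = (i, i+1)(2n−i, 2n+1−i) for 1 ≤ i ≤ n−1. Then the type-B permutahedron equals the slice of the type-A permutahedron: convexHull{w·a : w ∈ W_n} = convexHull{w·a : w ∈ S_{2n}} ∩ V′. -/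
noncomputable section

namespace CambrianPaperTypeB

/-- The base point `a = ∑_{k=1}^{2n} (k - (2n+1)/2) e_k` of `ℝ^{2n}` (with `0`-based
indexing: the `k`-th coordinate is `(k+1) - (2n+1)/2`). -/
def basePt (n : ℕ) : Fin (2 * n) → ℝ := fun k => ((k : ℕ) : ℝ) + 1 - (2 * n + 1) / 2

/-- The point `w · a` obtained by permuting the coordinates of the base point. -/
def pt (n : ℕ) (w : Equiv.Perm (Fin (2 * n))) : Fin (2 * n) → ℝ :=
  fun i => basePt n (w.symm i)

/-- The subspace `V' = {x ∈ ℝ^{2n} : x_i + x_{2n+1-i} = 0 for 1 ≤ i ≤ n}` (with `0`-based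
indexing: `x_j + x_{2n-1-j} = 0` for all `j`). -/
def Vprime (n : ℕ) : Set (Fin (2 * n) → ℝ) := {x | ∀ j : Fin (2 * n), x j + x j.rev = 0}

/-- The generators of the hyperoctahedral group `W_n ≤ S_{2n}`: the transposition
`s₀ = (n, n+1)` and the products `s_{n-i} = (i, i+1)(2n-i, 2n+1-i)` for `1 ≤ i ≤ n-1`
(all written in `1`-based indexing; below indices are `0`-based). -/
def gens (n : ℕ) (hn : 2 ≤ n) : Set (Equiv.Perm (Fin (2 * n))) :=
  {Equiv.swap ⟨n - 1, by omega⟩ ⟨n, by omega⟩} ∪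
  {σ | ∃ i : ℕ, ∃ _h1 : 1 ≤ i, ∃ _h2 : i ≤ n - 1,
    σ = Equiv.swap ⟨i - 1, by omega⟩ ⟨i, by omega⟩ *
        Equiv.swap ⟨2 * n - i - 1, by omega⟩ ⟨2 * n - i, by omega⟩}

/-- The hyperoctahedral group commutes with the reversal of the coordinates. -/
theorem rev_apply_of_mem_closure_gens {n : ℕ} {hn : 2 ≤ n} {w : Equiv.Perm (Fin (2 * n))}
    (hw : w ∈ Subgroup.closure (gens n hn)) (j : Fin (2 * n)) : w j.rev = (w j).rev := by
  induction hw using Subgroup.closure_induction generalizing j with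
  | mem x hx =>
    obtain rfl | ⟨i, h1, h2, rfl⟩ := hx
    · simp only [Equiv.swap_apply_def, Fin.ext_iff, Fin.val_rev]
      split_ifs <;> simp only [Fin.val_rev] at * <;> omega
    · simp only [Equiv.Perm.mul_apply, Equiv.swap_apply_def, Fin.ext_iff, Fin.val_rev]
      split_ifs <;> simp only [Fin.val_rev] at * <;> omega
  | one => rfl
  | mul x y _ _ hx hy => simp only [Equiv.Perm.mul_apply, hx, hy]
  | inv x _ hx => rw [Equiv.Perm.inv_eq_iff_eq, hx]; simp

theorem basePt_add_basePt_rev (n : ℕ) (j : Fin (2 * n)) :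
    basePt n j + basePt n j.rev = 0 := by
  have h : ((j : ℕ) : ℝ) + ((j.rev : ℕ) : ℝ) + 1 = 2 * n := by
    have : (j : ℕ) + (j.rev : ℕ) + 1 = 2 * n := by rw [Fin.val_rev]; omega
    exact_mod_cast this
  simp only [basePt]
  linarith

theorem pt_mem_Vprime {n : ℕ} {hn : 2 ≤ n} {w : Equiv.Perm (Fin (2 * n))}
    (hw : w ∈ Subgroup.closure (gens n hn)) : pt n w ∈ Vprime n := by
  intro j
  have h : w.symm j.rev = (w.symm j).rev := rev_apply_of_mem_closure_gens (inv_mem hw) j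
  simp only [pt, h, basePt_add_basePt_rev]

theorem convex_Vprime (n : ℕ) : Convex ℝ (Vprime n) := by
  intro x hx y hy s t _ _ _ j
  simp only [Pi.add_apply, Pi.smul_apply, smul_eq_mul]
  linear_combination s * hx j + t * hy j

theorem monotone_basePt (n : ℕ) : Monotone (basePt n) := by
  intro i j h
  have : ((i : ℕ) : ℝ) ≤ ((j : ℕ) : ℝ) := by exact_mod_cast h
  simp only [basePt]
  linarith

theorem sum_mul_comp_swap {ι : Type*} [Fintype ι] [DecidableEq ι] (d a : ι → ℝ) {p q : ι}
    (hpq : p ≠ q) :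
    ∑ j, d j * a (Equiv.swap p q j) = ∑ j, d j * a j + (d p - d q) * (a q - a p) := by
  have h : ∑ j, (d j * a (Equiv.swap p q j) - d j * a j) = (d p - d q) * (a q - a p) := by
    rw [Fintype.sum_eq_add p q hpq]
    · rw [Equiv.swap_apply_left, Equiv.swap_apply_right]
      ring
    · rintro j ⟨hp, hq⟩
      rw [Equiv.swap_apply_of_ne_of_ne hp hq, sub_self]
  rw [Finset.sum_sub_distrib] at h
  linarith

theorem monotone_of_le_next {m : ℕ} {d : Fin m → ℝ}
    (h : ∀ k (hk : k + 1 < m), d ⟨k, by omega⟩ ≤ d ⟨k + 1, hk⟩) : Monotone d := by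
  have key : ∀ j k (hk : j + k < m), d ⟨j, by omega⟩ ≤ d ⟨j + k, hk⟩ := by
    intro j k
    induction k with
    | zero => intro _; exact le_rfl
    | succ k ih => intro hk; exact (ih (by omega)).trans (h (j + k) hk)
  intro i j hij
  obtain ⟨k, hk⟩ := Nat.exists_eq_add_of_le (Fin.le_def.1 hij)
  have := key i k (by omega)
  simpa only [← hk] using this

/-- An antisymmetric sequence of coefficients whose pairing with the base point does not increase
under the generators of the hyperoctahedral group is monotone. -/
theorem monotone_of_sum_mul_gens_le {n : ℕ} (hn : 2 ≤ n) {d : Fin (2 * n) → ℝ}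
    (hd : ∀ j, d j.rev = -d j)
    (hs : ∀ s ∈ gens n hn, ∑ j, d j * basePt n (s j) ≤ ∑ j, d j * basePt n j) :
    Monotone d := by
  have hlow : ∀ k (hk : k + 1 < n), d ⟨k, by omega⟩ ≤ d ⟨k + 1, by omega⟩ := by
    intro k hk
    have h := hs _ (Or.inr ⟨k + 1, by omega, by omega, rfl⟩)
    simp only [Equiv.Perm.mul_apply] at h
    rw [sum_mul_comp_swap d (fun x => basePt n (Equiv.swap _ _ x))
        (by simp only [ne_eq, Fin.mk.injEq]; omega),
      sum_mul_comp_swap d (basePt n) (by simp only [ne_eq, Fin.mk.injEq]; omega),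
      Equiv.swap_apply_of_ne_of_ne (by simp only [ne_eq, Fin.mk.injEq]; omega)
        (by simp only [ne_eq, Fin.mk.injEq]; omega),
      Equiv.swap_apply_of_ne_of_ne (by simp only [ne_eq, Fin.mk.injEq]; omega)
        (by simp only [ne_eq, Fin.mk.injEq]; omega)] at h
    have e1 : (⟨2 * n - (k + 1) - 1, by omega⟩ : Fin (2 * n))
        = (⟨k + 1, by omega⟩ : Fin (2 * n)).rev := by
      simp only [Fin.ext_iff, Fin.val_rev]; omega
    have e2 : (⟨2 * n - (k + 1), by omega⟩ : Fin (2 * n))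
        = (⟨k, by omega⟩ : Fin (2 * n)).rev := by
      simp only [Fin.ext_iff, Fin.val_rev]
    have b1 := basePt_add_basePt_rev n ⟨k, by omega⟩
    have b2 := basePt_add_basePt_rev n ⟨k + 1, by omega⟩
    have b3 : basePt n ⟨k + 1, by omega⟩ - basePt n ⟨k, by omega⟩ = 1 := by
      simp only [basePt]; push_cast; ring
    simp only [e1, e2, hd, Nat.add_sub_cancel] at h
    rw [show basePt n (Fin.rev ⟨k, by omega⟩) - basePt n (Fin.rev ⟨k + 1, by omega⟩) = 1 by
      linarith, b3] at h
    linarith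
  apply monotone_of_le_next
  intro k hk
  rcases lt_trichotomy (k + 1) n with h | h | h
  · exact hlow k h
  · have h0 := hs _ (Or.inl rfl)
    rw [sum_mul_comp_swap d (basePt n) (by simp only [ne_eq, Fin.mk.injEq]; omega)] at h0
    subst h
    have b : basePt (k + 1) ⟨k + 1, by omega⟩ - basePt (k + 1) ⟨k, by omega⟩ = 1 := by
      simp only [basePt]; push_cast; ring
    simp only [Nat.add_sub_cancel, b] at h0
    linarith
  · have h0 := hlow (2 * n - 1 - (k + 1)) (by omega)
    have e1 : (⟨2 * n - 1 - (k + 1), by omega⟩ : Fin (2 * n)) = Fin.rev ⟨k + 1, hk⟩ := by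
      simp only [Fin.ext_iff, Fin.val_rev]; omega
    have e2 : (⟨2 * n - 1 - (k + 1) + 1, by omega⟩ : Fin (2 * n))
        = Fin.rev ⟨k, by omega⟩ := by
      simp only [Fin.ext_iff, Fin.val_rev]; omega
    rw [e1, e2, hd, hd] at h0
    linarith

theorem sum_mul_pt (n : ℕ) (c : Fin (2 * n) → ℝ) (w v : Equiv.Perm (Fin (2 * n))) :
    ∑ i, c i * pt n v i = ∑ j, c (w j) * basePt n (v.symm (w j)) :=
  (Equiv.sum_comp w fun i => c i * basePt n (v.symm i)).symm

/-- A linear functional with antisymmetric coefficients attains its maximum over the type-`A`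
permutahedron at a vertex of the type-`B` permutahedron. -/
theorem exists_forall_sum_mul_le {n : ℕ} (hn : 2 ≤ n) {c : Fin (2 * n) → ℝ}
    (hc : ∀ j, c j.rev = -c j) :
    ∃ w ∈ Subgroup.closure (gens n hn), ∀ v : Equiv.Perm (Fin (2 * n)),
      ∑ i, c i * pt n v i ≤ ∑ i, c i * pt n w i := by
  obtain ⟨w, hw, hmax⟩ := Set.exists_max_image
    (Subgroup.closure (gens n hn) : Set (Equiv.Perm (Fin (2 * n))))
    (fun v => ∑ i, c i * pt n v i) (Set.toFinite _) ⟨1, one_mem _⟩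
  have hval : ∑ i, c i * pt n w i = ∑ j, c (w j) * basePt n j := by
    rw [sum_mul_pt n c w w]
    simp only [Equiv.symm_apply_apply]
  have hmono : Monotone fun j => c (w j) := by
    refine monotone_of_sum_mul_gens_le hn (fun j => ?_) (fun s hs => ?_)
    · rw [rev_apply_of_mem_closure_gens hw, hc]
    · have h := hmax (w * s⁻¹) (mul_mem hw (inv_mem (Subgroup.subset_closure hs)))
      rw [hval, sum_mul_pt n c w] at h
      have e (j) : (w * s⁻¹).symm (w j) = s j := by
        simp [Equiv.symm_apply_eq]
      simpa only [e] using h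
  refine ⟨w, hw, fun v => ?_⟩
  rw [hval, sum_mul_pt n c w v]
  exact (hmono.monovary (monotone_basePt n)).sum_mul_comp_perm_le_sum_mul (σ := w.trans v.symm)

theorem sum_mul_eq_of_mem_Vprime {n : ℕ} (f : Fin (2 * n) → ℝ) {y : Fin (2 * n) → ℝ}
    (hy : y ∈ Vprime n) : ∑ i, (f i - f i.rev) / 2 * y i = ∑ i, f i * y i := by
  have h : ∑ i, f i.rev * y i = -∑ i, f i * y i := by
    rw [← Equiv.sum_comp Fin.revPerm, ← Finset.sum_neg_distrib]
    refine Finset.sum_congr rfl fun i _ => ?_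
    simp only [Fin.revPerm_apply, Fin.rev_rev]
    linear_combination f i * hy i
  calc ∑ i, (f i - f i.rev) / 2 * y i
      = (∑ i, f i * y i - ∑ i, f i.rev * y i) / 2 := by
        rw [← Finset.sum_sub_distrib, Finset.sum_div]
        exact Finset.sum_congr rfl fun i _ => by ring
    _ = ∑ i, f i * y i := by rw [h]; ring

/-- For `n ≥ 2`, the type-`B` permutahedron (the convex hull of the
`W_n`-orbit of `a`) is the intersection of the type-`A` permutahedron (the convex hull of the
`S_{2n}`-orbit of `a`) with the subspace `V'`. -/
theorem statement15 (n : ℕ) (hn : 2 ≤ n) :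
    convexHull ℝ {x : Fin (2 * n) → ℝ | ∃ w ∈ Subgroup.closure (gens n hn), x = pt n w}
      = convexHull ℝ {x : Fin (2 * n) → ℝ | ∃ w : Equiv.Perm (Fin (2 * n)), x = pt n w}
        ∩ Vprime n := by
  apply Set.Subset.antisymm
  · refine convexHull_min ?_ ((convex_convexHull ℝ _).inter (convex_Vprime n))
    rintro _ ⟨w, hw, rfl⟩
    exact ⟨subset_convexHull ℝ _ ⟨w, rfl⟩, pt_mem_Vprime hw⟩
  · rintro x ⟨hx, hxV⟩
    by_contra hxW
    have hfin : {x : Fin (2 * n) → ℝ | ∃ w ∈ Subgroup.closure (gens n hn), x = pt n w}.Finite :=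
      (Set.finite_range (pt n)).subset (by rintro _ ⟨w, _, rfl⟩; exact ⟨w, rfl⟩)
    obtain ⟨f, u, hfu, hux⟩ := geometric_hahn_banach_closed_point (convex_convexHull ℝ _)
      (hfin.isClosed_convexHull ℝ) hxW
    have hf (y : Fin (2 * n) → ℝ) (hy : y ∈ Vprime n) :
        f y = ∑ i, (f (Pi.single i 1) - f (Pi.single i.rev 1)) / 2 * y i := by
      rw [sum_mul_eq_of_mem_Vprime (fun i => f (Pi.single i 1)) hy]
      conv_lhs => rw [pi_eq_sum_univ' y, map_sum]
      exact Finset.sum_congr rfl fun i _ => by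
        rw [map_smul, smul_eq_mul, mul_comm]
    obtain ⟨w, hw, hmax⟩ := exists_forall_sum_mul_le hn
      (c := fun i => (f (Pi.single i 1) - f (Pi.single i.rev 1)) / 2)
      (fun j => by rw [Fin.rev_rev]; ring)
    have hle := convexHull_min (t := {y | ∑ i, (f (Pi.single i 1) - f (Pi.single i.rev 1)) / 2 * y i
        ≤ ∑ i, (f (Pi.single i 1) - f (Pi.single i.rev 1)) / 2 * pt n w i})
      (by rintro _ ⟨v, rfl⟩; exact hmax v)
      (convex_halfSpace_le (dotProductBilin ℝ ℝ _).isLinear _) hx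
    have hlt := (hfu _ (subset_convexHull ℝ _ ⟨w, hw, rfl⟩)).trans hux
    rw [hf _ (pt_mem_Vprime hw), hf x hxV] at hlt
    exact hlt.not_ge hle

end CambrianPaperTypeB

end
end
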